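/- There is a computable function F : ℚ × ℚ × ℚ × ℚ → Bool such that for all rationals c, d ∈ (0,1) and all rationals x0, t ∈ [0,1), with f the bijective two-interval PAM determined by c and d: F (c, d, x0, t) = true if and only if there exists n : ℕ with f^[n] x0 = t. (Reachability is decidable for bijective two-interval PAM.) -/

import Mathlib

/-- The bijective two-interval PAM determined by `c, d ∈ (0,1)`, as a map `ℚ → ℚ`:
it sends `[0,c)` onto `[d,1)` and `[c,1)` onto `[0,d)`. -/
def bpamQ (c d : ℚ) (x : ℚ) : ℚ :=
  if 0 ≤ x ∧ x < c then (1 - d) / c * x + d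
  else if c ≤ x ∧ x < 1 then d / (1 - c) * x - c * d / (1 - c)
  else 0

/-- structural code of a rational -/
def ratCode (q : ℚ) : ℕ := Nat.pair (if 0 ≤ q.num then 2 * q.num.natAbs else 2 * q.num.natAbs - 1) q.den

def ratMem (m : ℕ) : Prop :=
  0 < m.unpair.2 ∧ ∀ k < m.unpair.2 + 1, (((m.unpair.1 + 1) / 2) % k = 0 ∧ m.unpair.2 % k = 0) → k = 1

instance : DecidablePred ratMem := fun m => by unfold ratMem; infer_instance

theorem int_code (z : ℤ) : Encodable.encode z = if 0 ≤ z then 2 * z.natAbs else 2 * z.natAbs - 1 := by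
  cases z with
  | ofNat n => rw [if_pos (by simp)]; rfl
  | negSucc n => rw [if_neg (by simp)]; show 2 * n + 1 = 2 * (n+1) - 1; omega

theorem ratCode_eq (q : ℚ) : @Encodable.encode ℚ Rat.instEncodable q = ratCode q := by
  unfold ratCode
  rw [← int_code]
  rfl

theorem ratMem_iff (m : ℕ) : ratMem m ↔ m ∈ Set.range (@Encodable.encode ℚ Rat.instEncodable) := by
  have key : ∀ z d : ℕ, 0 < d → ((∀ k < d + 1, (z % k = 0 ∧ d % k = 0) → k = 1) ↔ Nat.Coprime z d) := by
    intro z d hd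
    constructor
    · intro h
      refine h _ (Nat.lt_succ_of_le (Nat.gcd_le_right _ hd)) ⟨?_, ?_⟩
      · exact Nat.mod_eq_zero_of_dvd (Nat.gcd_dvd_left _ _)
      · exact Nat.mod_eq_zero_of_dvd (Nat.gcd_dvd_right _ _)
    · intro h k _ ⟨h1, h2⟩
      exact Nat.eq_one_of_dvd_coprimes h (Nat.dvd_of_mod_eq_zero h1) (Nat.dvd_of_mod_eq_zero h2)
  constructor
  · rintro ⟨h1, h2⟩
    rw [key _ _ h1] at h2
    obtain ⟨z, hz⟩ : ∃ z : ℤ, z.natAbs = (m.unpair.1 + 1) / 2 ∧ (if 0 ≤ z then 2 * z.natAbs else 2 * z.natAbs - 1) = m.unpair.1 := by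
      rcases Nat.even_or_odd' m.unpair.1 with ⟨a, ha | ha⟩
      · refine ⟨a, ?_, ?_⟩ <;> simp <;> omega
      · refine ⟨-(a+1), ?_, ?_⟩
        · omega
        · rw [if_neg (by omega)]; omega
    refine ⟨⟨z, m.unpair.2, by omega, by rw [hz.1]; exact h2⟩, ?_⟩
    rw [ratCode_eq]
    simp only [ratCode]
    rw [hz.2, Nat.pair_unpair]
  · rintro ⟨q, rfl⟩
    rw [ratCode_eq]
    simp only [ratMem, ratCode, Nat.unpair_pair]
    refine ⟨q.pos, ?_⟩
    rw [key _ _ q.pos]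
    convert q.reduced using 1
    split_ifs <;> omega

theorem encode_rat (q : ℚ) : @Encodable.encode ℚ Primcodable.toEncodable q = ((List.range (ratCode q)).filter (fun m => ratMem m)).length := by
  rw [← ratCode_eq, ← List.countP_eq_length_filter]
  have : @Encodable.encode ℚ Primcodable.toEncodable q = (List.range (@Encodable.encode ℚ Rat.instEncodable q)).countP
    (fun m => @decide _ (Encodable.decidableRangeEncode ℚ m)) := rfl
  rw [this]
  congr 1
  funext m
  exact decide_eq_decide.2 (ratMem_iff m).symm

theorem primrec_ratMem : PrimrecPred ratMem := by
  have u1 : Primrec (fun m : ℕ => m.unpair.1) := Primrec.fst.comp Primrec.unpair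
  have u2 : Primrec (fun m : ℕ => m.unpair.2) := Primrec.snd.comp Primrec.unpair
  refine PrimrecPred.and (Primrec.nat_lt.comp (Primrec.const 0) u2) ?_
  have R : PrimrecRel (fun k m : ℕ => (((m.unpair.1 + 1) / 2) % k = 0 ∧ m.unpair.2 % k = 0) → k = 1) := by
    have h1 : PrimrecRel (fun k m : ℕ => ((m.unpair.1 + 1) / 2) % k = 0) :=
      Primrec.eq.comp (Primrec.nat_mod.comp (Primrec.nat_div.comp (Primrec.succ.comp (u1.comp Primrec.snd)) (Primrec.const 2)) Primrec.fst) (Primrec.const 0)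
    have h2 : PrimrecRel (fun k m : ℕ => m.unpair.2 % k = 0) :=
      Primrec.eq.comp (Primrec.nat_mod.comp (u2.comp Primrec.snd) Primrec.fst) (Primrec.const 0)
    have h3 : PrimrecRel (fun k _ : ℕ => k = 1) := Primrec.eq.comp Primrec.fst (Primrec.const 1)
    refine (PrimrecPred.or (PrimrecPred.not (PrimrecPred.and h1 h2)) h3).of_eq ?_
    intro x; tauto
  exact R.forall_lt.comp (Primrec.succ.comp u2) Primrec.id

theorem count_lt {m n : ℕ} (h : m < n) (hm : ratMem m) :
   ((List.range m).filter (fun m => ratMem m)).length < ((List.range n).filter (fun m => ratMem m)).length := by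
  rw [← List.countP_eq_length_filter, ← List.countP_eq_length_filter]
  exact Nat.count_strict_mono (p := ratMem) hm h

theorem computable_ratCode : Computable ratCode := by
  have hp : PrimrecRel (fun (q : ℚ) (m : ℕ) => ratMem m ∧ ((List.range m).filter (fun m => ratMem m)).length = @Encodable.encode ℚ Primcodable.toEncodable q) := by
    refine PrimrecPred.and (primrec_ratMem.comp Primrec.snd) ?_
    refine Primrec.eq.comp (Primrec.list_length.comp ?_) (Primrec.encode.comp Primrec.fst)
    exact (Primrec.listFilter primrec_ratMem).comp (Primrec.list_range.comp Primrec.snd)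
  have hpc := hp.decide.to_comp
  have := Partrec.rfind hpc.partrec₂
  refine this.of_eq fun q => ?_
  refine Part.eq_some_iff.2 ?_
  have hm : ∀ q, ratMem (ratCode q) := fun q => by rw [ratMem_iff, ← ratCode_eq]; exact ⟨q, rfl⟩
  refine Nat.mem_rfind.2 ⟨?_, ?_⟩
  · simp [hm q, encode_rat q]
  · intro m hlt
    simp
    intro h1 h2
    have := count_lt hlt h1
    rw [encode_rat q] at h2
    omega

def ratPair (q : ℚ) : ℕ × ℕ := ((ratCode q).unpair.1 / 2, (ratCode q).unpair.2)

theorem computable_ratPair : Computable ratPair := by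
  have : Primrec (fun m : ℕ => (m.unpair.1 / 2, m.unpair.2)) :=
    Primrec.pair (Primrec.nat_div.comp (Primrec.fst.comp Primrec.unpair) (Primrec.const 2)) (Primrec.snd.comp Primrec.unpair)
  exact this.to_comp.comp computable_ratCode

theorem ratPair_snd (q : ℚ) : (ratPair q).2 = q.den := by simp [ratPair, ratCode]

theorem ratPair_fst (q : ℚ) (h : 0 ≤ q) : ((ratPair q).1 : ℤ) = q.num := by
  have := Rat.num_nonneg.2 h
  simp [ratPair, ratCode, this]

theorem rat_eq_one_of_val {x : ℚ} (hx : 0 < x) (h : ∀ p : ℕ, p.Prime → padicValRat p x = 0) : x = 1 := by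
  have hn : 0 < x.num := Rat.num_pos.2 hx
  have hval : ∀ p : ℕ, p.Prime → ¬ (p ∣ x.num.natAbs) ∧ ¬ (p ∣ x.den) := by
    intro p hp
    have := Fact.mk hp
    have h0 := h p hp
    unfold padicValRat at h0
    unfold padicValInt at h0
    have key : ∀ m : ℕ, m ≠ 0 → (p ∣ m ↔ padicValNat p m ≠ 0) := by
      intro m hm
      exact dvd_iff_padicValNat_ne_zero hm
    rw [key _ (by omega), key _ x.den_nz]
    by_contra hcon
    have e : padicValNat p x.num.natAbs = padicValNat p x.den := by omega
    have e1 : padicValNat p x.num.natAbs ≠ 0 := by omega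
    have e2 : padicValNat p x.den ≠ 0 := by omega
    have d1 := (key _ (by omega)).2 e1
    have d2 := (key _ x.den_nz).2 e2
    exact hp.one_lt.ne' (Nat.eq_one_of_dvd_coprimes x.reduced d1 d2)
  have h1 : x.num.natAbs = 1 := Nat.eq_one_iff_not_exists_prime_dvd.2 fun p hp => (hval p hp).1
  have h2 : x.den = 1 := Nat.eq_one_iff_not_exists_prime_dvd.2 fun p hp => (hval p hp).2
  have h3 : x.num = 1 := by omega
  rw [← Rat.num_div_den x, h2, h3]; norm_num

theorem val_bound {p : ℕ} (hp : p.Prime) {u w M : ℕ} (hu : 0 < u) (hw : 0 < w) (huM : u ≤ M) (hwM : w ≤ M) :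
    |padicValRat p ((u : ℚ) / w)| ≤ M := by
  have := Fact.mk hp
  have key : ∀ m : ℕ, 0 < m → m ≤ M → padicValNat p m ≤ M := by
    intro m h0 h
    have := Nat.le_of_dvd h0 (pow_padicValNat_dvd (p := p) (n := m))
    have := Nat.lt_pow_self hp.one_lt (n := padicValNat p m)
    omega
  rw [padicValRat.div (by positivity) (by positivity), padicValRat.of_nat, padicValRat.of_nat]
  have := key u hu huM
  have := key w hw hwM
  rw [abs_le]; constructor <;> omega

theorem mult_bound {a s r : ℚ} {M : ℕ} (ha : 0 < a) (hs : 0 < s) (hs1 : s ≠ 1)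
    (bs : ∀ p : ℕ, p.Prime → |padicValRat p s| ≤ M)
    (br : ∀ p : ℕ, p.Prime → |padicValRat p r| ≤ M)
    (n : ℕ) (m : ℤ) (h : a ^ n * s ^ m = r) :
    ∃ n' : ℕ, n' ≤ 2 * M * M + M ∧ ∃ m' : ℤ, a ^ n' * s ^ m' = r := by
  obtain ⟨p, hp, hps⟩ : ∃ p : ℕ, p.Prime ∧ padicValRat p s ≠ 0 := by
    by_contra hcon
    push Not at hcon
    exact hs1 (rat_eq_one_of_val hs hcon)
  have hval : ∀ q : ℕ, q.Prime → padicValRat q r = n * padicValRat q a + m * padicValRat q s := by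
    intro q hq
    have := Fact.mk hq
    rw [← h, padicValRat.mul (by positivity) (by positivity), padicValRat.pow, padicValRat.zpow]
  by_cases hdet : ∀ q : ℕ, q.Prime → padicValRat p a * padicValRat q s = padicValRat q a * padicValRat p s
  · have hrel : a ^ (padicValRat p s) = s ^ (padicValRat p a) := by
      have : a ^ (padicValRat p s) / s ^ (padicValRat p a) = 1 := by
        apply rat_eq_one_of_val (by positivity)
        intro q hq
        have := Fact.mk hq
        rw [padicValRat.div (by positivity) (by positivity), padicValRat.zpow, padicValRat.zpow, hdet q hq]
        ring
      exact (div_eq_one_iff_eq (by positivity)).1 this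
    obtain ⟨j, hj⟩ : ∃ j : ℤ, a ^ (padicValRat p s).natAbs = s ^ j := by
      rcases Int.natAbs_eq (padicValRat p s) with e | e
      · exact ⟨padicValRat p a, by rw [← hrel]; conv_rhs => rw [e]
                                   rw [zpow_natCast]⟩
      · refine ⟨-padicValRat p a, ?_⟩
        rw [zpow_neg, ← hrel]
        conv_rhs => rw [e]
        rw [zpow_neg, inv_inv, zpow_natCast]
    set i := (padicValRat p s).natAbs with hi
    have hi0 : 0 < i := Int.natAbs_pos.2 hps
    refine ⟨n % i, ?_, j * (n / i : ℕ) + m, ?_⟩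
    · have := Nat.mod_lt n hi0
      have := bs p hp
      have : i ≤ M := by rw [Int.abs_eq_natAbs] at this; omega
      have : 0 ≤ 2 * M * M := by positivity
      omega
    · rw [← h, zpow_add₀ hs.ne', zpow_mul, ← hj, zpow_natCast, ← mul_assoc, ← pow_mul, ← pow_add, Nat.mod_add_div]
  · push Not at hdet
    obtain ⟨q, hq, hne⟩ := hdet
    refine ⟨n, ?_, m, h⟩
    have e1 := hval p hp
    have e2 := hval q hq
    have e : (n : ℤ) * (padicValRat p a * padicValRat q s - padicValRat q a * padicValRat p s)
        = padicValRat p r * padicValRat q s - padicValRat q r * padicValRat p s := by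
      rw [e1, e2]; ring
    have h1 : (1 : ℤ) ≤ |padicValRat p a * padicValRat q s - padicValRat q a * padicValRat p s| :=
      Int.one_le_abs (sub_ne_zero.2 hne)
    have h2 := congrArg abs e
    rw [abs_mul] at h2
    have h3 : |padicValRat p r * padicValRat q s| ≤ M * M := by
      rw [abs_mul]; exact mul_le_mul (br p hp) (bs q hq) (abs_nonneg _) (by positivity)
    have h4 : |padicValRat q r * padicValRat p s| ≤ M * M := by
      rw [abs_mul]; exact mul_le_mul (br q hq) (bs p hp) (abs_nonneg _) (by positivity)
    have h5 := abs_sub (padicValRat p r * padicValRat q s) (padicValRat q r * padicValRat p s)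
    have h6 : (n : ℤ) ≤ |(n : ℤ)| * |padicValRat p a * padicValRat q s - padicValRat q a * padicValRat p s| := by
      rw [abs_of_nonneg (by positivity : (0 : ℤ) ≤ n)]
      nlinarith [(by positivity : (0 : ℤ) ≤ n)]
    zify
    have : (0 : ℤ) ≤ M := by positivity
    nlinarith

def bpamY (c d x : ℚ) : ℚ := x * (1 - c - d) + c * d

theorem bpamQ_mem {c d x : ℚ} (hc : 0 < c) (hc1 : c < 1) (hd : 0 < d) (hd1 : d < 1)
    (hx : x ∈ Set.Ico (0 : ℚ) 1) : bpamQ c d x ∈ Set.Ico (0 : ℚ) 1 := by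
  obtain ⟨h0, h1⟩ := hx
  unfold bpamQ
  have hc' : 0 < 1 - c := by linarith
  have hd' : 0 < 1 - d := by linarith
  split_ifs with h2 h3
  · constructor
    · positivity
    · have : (1 - d) / c * x < (1 - d) / c * c := mul_lt_mul_of_pos_left h2.2 (by positivity)
      rw [div_mul_cancel₀ _ hc.ne'] at this
      linarith
  · have e : d / (1 - c) * x - c * d / (1 - c) = d * ((x - c) / (1 - c)) := by field_simp
    rw [e]
    have : (x - c) / (1 - c) < 1 := by rw [div_lt_one hc']; linarith
    have h5 : 0 ≤ (x - c) / (1 - c) := div_nonneg (by linarith) hc'.le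
    constructor
    · positivity
    · nlinarith
  · simp

theorem iter_mem {c d x : ℚ} (hc : 0 < c) (hc1 : c < 1) (hd : 0 < d) (hd1 : d < 1)
    (hx : x ∈ Set.Ico (0 : ℚ) 1) (n : ℕ) : (bpamQ c d)^[n] x ∈ Set.Ico (0 : ℚ) 1 := by
  induction n with
  | zero => exact hx
  | succ n ih => rw [Function.iterate_succ_apply']; exact bpamQ_mem hc hc1 hd hd1 ih

theorem bpamY_step {c d x : ℚ} (hc : 0 < c) (hc1 : c < 1) (hd : 0 < d) (hd1 : d < 1)
    (hx : x ∈ Set.Ico (0 : ℚ) 1) :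
    ∃ m : ℤ, bpamY c d (bpamQ c d x) = (1 - d) / c * ((1 - c) * (1 - d) / (c * d)) ^ m * bpamY c d x := by
  obtain ⟨h0, h1⟩ := hx
  have hc' : 1 - c ≠ 0 := by linarith
  have hd' : 1 - d ≠ 0 := by linarith
  by_cases h : x < c
  · refine ⟨0, ?_⟩
    rw [bpamQ, if_pos ⟨h0, h⟩, zpow_zero]
    unfold bpamY
    field_simp
    ring
  · refine ⟨-1, ?_⟩
    rw [bpamQ, if_neg (by tauto), if_pos ⟨not_lt.1 h, h1⟩, zpow_neg_one]
    unfold bpamY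
    field_simp
    ring

theorem bpamY_iter {c d x : ℚ} (hc : 0 < c) (hc1 : c < 1) (hd : 0 < d) (hd1 : d < 1)
    (hx : x ∈ Set.Ico (0 : ℚ) 1) (n : ℕ) :
    ∃ m : ℤ, bpamY c d ((bpamQ c d)^[n] x) =
      ((1 - d) / c) ^ n * ((1 - c) * (1 - d) / (c * d)) ^ m * bpamY c d x := by
  have hc' : 0 < 1 - c := by linarith
  have hd' : 0 < 1 - d := by linarith
  have hs : (1 - c) * (1 - d) / (c * d) ≠ 0 := by positivity
  induction n with
  | zero => exact ⟨0, by simp⟩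
  | succ n ih =>
    obtain ⟨m, hm⟩ := ih
    obtain ⟨m', hm'⟩ := bpamY_step hc hc1 hd hd1 (iter_mem hc hc1 hd hd1 hx n)
    refine ⟨m' + m, ?_⟩
    rw [Function.iterate_succ_apply', hm', hm, pow_succ, zpow_add₀ hs]
    ring

theorem bpamY_pos {c d x : ℚ} (hc : 0 < c) (hc1 : c < 1) (hd : 0 < d) (hd1 : d < 1)
    (hx : x ∈ Set.Ico (0 : ℚ) 1) : 0 < bpamY c d x := by
  obtain ⟨h0, h1⟩ := hx
  have e : bpamY c d x = x * ((1 - c) * (1 - d)) + (1 - x) * (c * d) := by unfold bpamY; ring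
  have hc' : 0 < 1 - c := by linarith
  have hd' : 0 < 1 - d := by linarith
  have hx' : 0 < 1 - x := by linarith
  rw [e]; positivity

theorem bpamY_le {c d x : ℚ} (hc : 0 < c) (hc1 : c < 1) (hd : 0 < d) (hd1 : d < 1)
    (hx : x ∈ Set.Ico (0 : ℚ) 1) : bpamY c d x ≤ 1 := by
  obtain ⟨h0, h1⟩ := hx
  have e : bpamY c d x = x * ((1 - c) * (1 - d)) + (1 - x) * (c * d) := by unfold bpamY; ring
  rw [e]
  have : (1 - c) * (1 - d) ≤ 1 := by nlinarith
  have : c * d ≤ 1 := by nlinarith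
  nlinarith

theorem bpamY_inj {c d x y : ℚ} (hc : 0 < c) (hc1 : c < 1) (hd : 0 < d) (hd1 : d < 1)
    (hcd : 1 - c - d ≠ 0)
    (hx : x ∈ Set.Ico (0 : ℚ) 1) (hy : y ∈ Set.Ico (0 : ℚ) 1) (m : ℤ)
    (h : bpamY c d x = ((1 - c) * (1 - d) / (c * d)) ^ m * bpamY c d y) : x = y := by
  have hc' : 0 < 1 - c := by linarith
  have hd' : 0 < 1 - d := by linarith
  have px := bpamY_pos hc hc1 hd hd1 hx
  have py := bpamY_pos hc hc1 hd hd1 hy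
  set s := (1 - c) * (1 - d) / (c * d) with hs
  have spos : 0 < s := by positivity
  have hm : s ^ m = bpamY c d x / bpamY c d y := by rw [h]; field_simp
  have hm0 : m = 0 := by
    rcases lt_or_gt_of_ne hcd with hlt | hgt
    · have bnd : ∀ z ∈ Set.Ico (0 : ℚ) 1, s * (c * d) < bpamY c d z ∧ bpamY c d z ≤ c * d := by
        rintro z ⟨z0, z1⟩
        rw [hs, div_mul_cancel₀ _ (by positivity)]
        unfold bpamY
        constructor <;> nlinarith
      have s1 : s < 1 := by rw [hs, div_lt_one (by positivity)]; nlinarith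
      have b1 := bnd x hx
      have b2 := bnd y hy
      have u1 : s ^ (1 : ℤ) < s ^ m := by
        rw [hm, zpow_one, lt_div_iff₀ py]; nlinarith
      have u2 : s ^ m < s ^ (-1 : ℤ) := by
        rw [hm, zpow_neg_one, div_lt_iff₀ py, inv_mul_eq_div, lt_div_iff₀ spos]; nlinarith
      rw [zpow_lt_zpow_iff_right_of_lt_one₀ spos s1] at u1 u2
      omega
    · have bnd : ∀ z ∈ Set.Ico (0 : ℚ) 1, c * d ≤ bpamY c d z ∧ bpamY c d z < s * (c * d) := by
        rintro z ⟨z0, z1⟩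
        rw [hs, div_mul_cancel₀ _ (by positivity)]
        unfold bpamY
        constructor <;> nlinarith
      have s1 : 1 < s := by rw [hs, one_lt_div (by positivity)]; nlinarith
      have b1 := bnd x hx
      have b2 := bnd y hy
      have u1 : s ^ m < s ^ (1 : ℤ) := by
        rw [hm, zpow_one, div_lt_iff₀ py]; nlinarith
      have u2 : s ^ (-1 : ℤ) < s ^ m := by
        rw [hm, zpow_neg_one, lt_div_iff₀ py, inv_mul_eq_div, div_lt_iff₀ spos]; nlinarith
      rw [zpow_lt_zpow_iff_right₀ s1] at u1 u2
      omega
  rw [hm0, zpow_zero, one_mul] at h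
  unfold bpamY at h
  exact mul_right_cancel₀ hcd (by linarith)

theorem rot_iter {c d x : ℚ} (hc : 0 < c) (hc1 : c < 1) (hd : 0 < d) (hd1 : d < 1)
    (hcd : 1 - c - d = 0) (hx : x ∈ Set.Ico (0 : ℚ) 1) (n : ℕ) :
    ∃ m : ℤ, (bpamQ c d)^[n] x = x + n * d + m := by
  induction n with
  | zero => exact ⟨0, by simp⟩
  | succ n ih =>
    obtain ⟨m, hm⟩ := ih
    obtain ⟨h0, h1⟩ := iter_mem hc hc1 hd hd1 hx n
    rw [Function.iterate_succ_apply']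
    have e1 : 1 - d = c := by linarith
    have e2 : 1 - c = d := by linarith
    by_cases h : (bpamQ c d)^[n] x < c
    · refine ⟨m, ?_⟩
      rw [bpamQ, if_pos ⟨h0, h⟩, hm, e1, div_self hc.ne']
      push_cast; ring
    · refine ⟨m - 1, ?_⟩
      rw [bpamQ, if_neg (by tauto), if_pos ⟨not_lt.1 h, h1⟩, hm, e2, div_self hd.ne', mul_div_cancel_right₀ _ hd.ne']
      push_cast; linarith

theorem bpamY_int {c d x : ℚ} (hc : 0 < c) (hc1 : c < 1) (hd : 0 < d) (hd1 : d < 1)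
    (hx : x ∈ Set.Ico (0 : ℚ) 1) (w : ℕ) (hw : 0 < w) :
    ∃ A : ℕ, 0 < A ∧ A ≤ c.den * d.den * x.den * w ∧
      (A : ℚ) = bpamY c d x * ((c.den * d.den * x.den * w : ℕ) : ℚ) := by
  have px := bpamY_pos hc hc1 hd hd1 hx
  have lx := bpamY_le hc hc1 hd hd1 hx
  have c0 := c.pos
  have d0 := d.pos
  have x0 := x.pos
  have e : (((x.num * (c.den * d.den - c.num * d.den - d.num * c.den) + c.num * d.num * x.den) * w : ℤ) : ℚ)
      = bpamY c d x * ((c.den * d.den * x.den * w : ℕ) : ℚ) := by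
    unfold bpamY
    push_cast
    have hcn : (c.num : ℚ) = c * c.den := (Rat.mul_den_eq_num c).symm
    have hdn : (d.num : ℚ) = d * d.den := (Rat.mul_den_eq_num d).symm
    have hxn : (x.num : ℚ) = x * x.den := (Rat.mul_den_eq_num x).symm
    rw [hcn, hdn, hxn]; ring
  set Z : ℤ := (x.num * (c.den * d.den - c.num * d.den - d.num * c.den) + c.num * d.num * x.den) * w with hZ
  have hMpos : (0 : ℚ) < ((c.den * d.den * x.den * w : ℕ) : ℚ) := by positivity
  have zpos : 0 < Z := by
    have : (0 : ℚ) < Z := by rw [e]; positivity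
    exact_mod_cast this
  have zle : Z ≤ ((c.den * d.den * x.den * w : ℕ) : ℤ) := by
    have : (Z : ℚ) ≤ ((c.den * d.den * x.den * w : ℕ) : ℚ) := by rw [e]; nlinarith
    exact_mod_cast this
  refine ⟨Z.toNat, by omega, by omega, ?_⟩
  rw [← e]
  have : ((Z.toNat : ℤ) : ℚ) = Z := by rw [Int.toNat_of_nonneg zpos.le]
  exact_mod_cast this

theorem reach_bound {c d x t : ℚ} (hc : 0 < c) (hc1 : c < 1) (hd : 0 < d) (hd1 : d < 1)
    (hx : x ∈ Set.Ico (0 : ℚ) 1) (ht : t ∈ Set.Ico (0 : ℚ) 1) (M : ℕ)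
    (hM : M = c.den * d.den * x.den * t.den) (n : ℕ) (h : (bpamQ c d)^[n] x = t) :
    ∃ n' : ℕ, n' ≤ 2 * M * M + M ∧ (bpamQ c d)^[n'] x = t := by
  have hc' : 0 < 1 - c := by linarith
  have hd' : 0 < 1 - d := by linarith
  have c0 := c.pos
  have d0 := d.pos
  have x0 := x.pos
  have t0 := t.pos
  have hMpos : 0 < M := by rw [hM]; positivity
  by_cases hcd : 1 - c - d = 0
  · refine ⟨n % d.den, ?_, ?_⟩
    · have h1 := Nat.mod_lt n d0
      have h2 : d.den ≤ M := Nat.le_of_dvd hMpos (by rw [hM]; exact ⟨c.den * x.den * t.den, by ring⟩)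
      have : 0 ≤ 2 * M * M := by positivity
      omega
    · obtain ⟨m, hm⟩ := rot_iter hc hc1 hd hd1 hcd hx n
      obtain ⟨m', hm'⟩ := rot_iter hc hc1 hd hd1 hcd hx (n % d.den)
      have i1 := iter_mem hc hc1 hd hd1 hx (n % d.den)
      rw [h] at hm
      have hn : (n : ℚ) = (n % d.den : ℕ) + d.den * (n / d.den : ℕ) := by
        exact_mod_cast (Nat.mod_add_div n d.den).symm
      generalize n / d.den = l at hn
      have hdn : (d.num : ℚ) = d * d.den := (Rat.mul_den_eq_num d).symm
      have e : (bpamQ c d)^[n % d.den] x - t = ((m' - m - d.num * l : ℤ) : ℚ) := by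
        rw [hm', hm, hn]
        push_cast
        rw [hdn]; ring
      have l1 : ((m' - m - d.num * l : ℤ) : ℚ) < 1 := by rw [← e]; linarith [i1.2, ht.1]
      have l2 : (-1 : ℚ) < ((m' - m - d.num * l : ℤ) : ℚ) := by rw [← e]; linarith [i1.1, ht.2]
      have l1' : (m' - m - d.num * l : ℤ) < 1 := by exact_mod_cast l1
      have l2' : -1 < (m' - m - d.num * l : ℤ) := by exact_mod_cast l2
      have l3 : (m' - m - d.num * l : ℤ) = 0 := by omega
      rw [l3] at e
      push_cast at e
      linarith
  · have px := bpamY_pos hc hc1 hd hd1 hx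
    have pt := bpamY_pos hc hc1 hd hd1 ht
    obtain ⟨m, hm⟩ := bpamY_iter hc hc1 hd hd1 hx n
    rw [h] at hm
    have hcn : (c.num : ℚ) = c * c.den := (Rat.mul_den_eq_num c).symm
    have hdn : (d.num : ℚ) = d * d.den := (Rat.mul_den_eq_num d).symm
    have bs : ∀ p : ℕ, p.Prime → |padicValRat p ((1 - c) * (1 - d) / (c * d))| ≤ M := by
      intro p hp
      have cn0 : 0 < c.num := Rat.num_pos.2 hc
      have dn0 : 0 < d.num := Rat.num_pos.2 hd
      have cn1 : c.num < c.den := by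
        have : (c.num : ℚ) < c.den := by
          rw [hcn]; nlinarith [(by exact_mod_cast c0 : (0 : ℚ) < c.den)]
        exact_mod_cast this
      have dn1 : d.num < d.den := by
        have : (d.num : ℚ) < d.den := by
          rw [hdn]; nlinarith [(by exact_mod_cast d0 : (0 : ℚ) < d.den)]
        exact_mod_cast this
      obtain ⟨a, ha⟩ := Int.eq_ofNat_of_zero_le cn0.le
      obtain ⟨b, hb⟩ := Int.eq_ofNat_of_zero_le dn0.le
      rw [ha] at hcn cn0 cn1
      rw [hb] at hdn dn0 dn1
      have le1 : c.den * d.den ≤ M := Nat.le_of_dvd hMpos (by rw [hM]; exact ⟨x.den * t.den, by ring⟩)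
      have e : (1 - c) * (1 - d) / (c * d)
          = (((c.den - a) * (d.den - b) : ℕ) : ℚ) / ((a * b : ℕ) : ℚ) := by
        push_cast [Nat.cast_sub (by omega : a ≤ c.den), Nat.cast_sub (by omega : b ≤ d.den)]
        push_cast at hcn hdn
        rw [hcn, hdn]
        have : (c.den : ℚ) ≠ 0 := by positivity
        have : (d.den : ℚ) ≠ 0 := by positivity
        field_simp
      rw [e]
      refine val_bound hp ?_ ?_ ?_ ?_
      · exact Nat.mul_pos (by omega) (by omega)
      · exact Nat.mul_pos (by omega) (by omega)
      · exact le_trans (Nat.mul_le_mul (by omega) (by omega)) le1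
      · exact le_trans (Nat.mul_le_mul (by omega) (by omega)) le1
    have br : ∀ p : ℕ, p.Prime → |padicValRat p (bpamY c d t / bpamY c d x)| ≤ M := by
      intro p hp
      obtain ⟨A, A0, AM, hA⟩ := bpamY_int hc hc1 hd hd1 ht x.den x0
      obtain ⟨B, B0, BM, hB⟩ := bpamY_int hc hc1 hd hd1 hx t.den t0
      have eM : c.den * d.den * t.den * x.den = M := by rw [hM]; ring
      rw [eM] at hA AM
      rw [← hM] at hB BM
      have e : bpamY c d t / bpamY c d x = (A : ℚ) / B := by
        rw [hA, hB]
        have : (M : ℚ) ≠ 0 := by positivity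
        field_simp
      rw [e]
      exact val_bound hp A0 B0 AM BM
    have s1 : (1 - c) * (1 - d) / (c * d) ≠ 1 := by
      intro hs
      rw [div_eq_one_iff_eq (by positivity)] at hs
      exact hcd (by linarith)
    obtain ⟨n', hn', m', hm'⟩ := mult_bound (a := (1 - d) / c) (by positivity) (by positivity) s1 bs br n m
      (by rw [hm]; field_simp)
    refine ⟨n', hn', ?_⟩
    obtain ⟨m'', hm''⟩ := bpamY_iter hc hc1 hd hd1 hx n'
    have hs0 : (1 - c) * (1 - d) / (c * d) ≠ 0 := by positivity
    refine bpamY_inj hc hc1 hd hd1 hcd (iter_mem hc hc1 hd hd1 hx n') ht (m'' - m') ?_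
    have e : bpamY c d t = ((1 - d) / c) ^ n' * ((1 - c) * (1 - d) / (c * d)) ^ m' * bpamY c d x := by
      rw [hm']; field_simp
    rw [hm'', e, zpow_sub₀ hs0]
    have := zpow_ne_zero m' hs0
    field_simp

/-- One step of the map on unreduced fractions. -/
def natStep (C D P : ℕ × ℕ) : ℕ × ℕ :=
  if P.1 * C.2 < C.1 * P.2 then
    ((D.2 - D.1) * C.2 * P.1 + D.1 * C.1 * P.2, D.2 * C.1 * P.2)
  else (D.1 * (P.1 * C.2 - C.1 * P.2), D.2 * (C.2 - C.1) * P.2)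

def natBound (C D X T : ℕ × ℕ) : ℕ := C.2 * D.2 * X.2 * T.2

def natTest (C D X T : ℕ × ℕ) (n : ℕ) : Prop :=
  ((natStep C D)^[n] X).1 * T.2 = T.1 * ((natStep C D)^[n] X).2

def natReach (v : (ℕ × ℕ) × (ℕ × ℕ) × (ℕ × ℕ) × (ℕ × ℕ)) : Prop :=
  ∃ n ∈ List.range (2 * natBound v.1 v.2.1 v.2.2.1 v.2.2.2 * natBound v.1 v.2.1 v.2.2.1 v.2.2.2
    + natBound v.1 v.2.1 v.2.2.1 v.2.2.2 + 1), natTest v.1 v.2.1 v.2.2.1 v.2.2.2 n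

theorem primrec_natReach : PrimrecPred natReach := by
  have hadd {α : Type} [Primcodable α] {f g : α → ℕ} (hf : Primrec f) (hg : Primrec g) :
      Primrec (fun a => f a + g a) := Primrec.nat_add.comp hf hg
  have hmul {α : Type} [Primcodable α] {f g : α → ℕ} (hf : Primrec f) (hg : Primrec g) :
      Primrec (fun a => f a * g a) := Primrec.nat_mul.comp hf hg
  have hsub {α : Type} [Primcodable α] {f g : α → ℕ} (hf : Primrec f) (hg : Primrec g) :
      Primrec (fun a => f a - g a) := Primrec.nat_sub.comp hf hg
  have h1 {α : Type} [Primcodable α] {f : α → ℕ × ℕ} (hf : Primrec f) :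
      Primrec (fun a => (f a).1) := Primrec.fst.comp hf
  have h2 {α : Type} [Primcodable α] {f : α → ℕ × ℕ} (hf : Primrec f) :
      Primrec (fun a => (f a).2) := Primrec.snd.comp hf
  have hstep {α : Type} [Primcodable α] {C D P : α → ℕ × ℕ} (hC : Primrec C) (hD : Primrec D)
      (hP : Primrec P) : Primrec (fun a => natStep (C a) (D a) (P a)) := by
    unfold natStep
    refine Primrec.ite (Primrec.nat_lt.comp (hmul (h1 hP) (h2 hC)) (hmul (h1 hC) (h2 hP))) ?_ ?_
    · exact Primrec.pair
        (hadd (hmul (hmul (hsub (h2 hD) (h1 hD)) (h2 hC)) (h1 hP)) (hmul (hmul (h1 hD) (h1 hC)) (h2 hP)))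
        (hmul (hmul (h2 hD) (h1 hC)) (h2 hP))
    · exact Primrec.pair
        (hmul (h1 hD) (hsub (hmul (h1 hP) (h2 hC)) (hmul (h1 hC) (h2 hP))))
        (hmul (hmul (h2 hD) (hsub (h2 hC) (h1 hC))) (h2 hP))
  let V := (ℕ × ℕ) × (ℕ × ℕ) × (ℕ × ℕ) × (ℕ × ℕ)
  have pC : Primrec (fun v : V => v.1) := Primrec.fst
  have pD : Primrec (fun v : V => v.2.1) := Primrec.fst.comp Primrec.snd
  have pX : Primrec (fun v : V => v.2.2.1) := Primrec.fst.comp (Primrec.snd.comp Primrec.snd)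
  have pT : Primrec (fun v : V => v.2.2.2) := Primrec.snd.comp (Primrec.snd.comp Primrec.snd)
  have hb : Primrec (fun v : V => natBound v.1 v.2.1 v.2.2.1 v.2.2.2) :=
    hmul (hmul (hmul (h2 pC) (h2 pD)) (h2 pX)) (h2 pT)
  have hiter : Primrec (fun w : ℕ × V => (natStep w.2.1 w.2.2.1)^[w.1] w.2.2.2.1) :=
    Primrec.nat_iterate Primrec.fst (pX.comp Primrec.snd)
      (hstep (pC.comp (Primrec.snd.comp Primrec.fst)) (pD.comp (Primrec.snd.comp Primrec.fst)) Primrec.snd)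
  have hR : PrimrecRel (fun (n : ℕ) (v : V) => natTest v.1 v.2.1 v.2.2.1 v.2.2.2 n) := by
    unfold natTest
    exact Primrec.eq.comp (hmul (h1 hiter) (h2 (pT.comp Primrec.snd)))
      (hmul (h1 (pT.comp Primrec.snd)) (h2 hiter))
  exact hR.exists_mem_list.comp
    (Primrec.list_range.comp (hadd (hadd (hmul (hmul (Primrec.const 2) hb) hb) hb) (Primrec.const 1))) Primrec.id

theorem natStep_spec {c d x : ℚ} (hc : 0 < c) (hc1 : c < 1) (hd : 0 < d) (hd1 : d < 1)
    (hx : x ∈ Set.Ico (0 : ℚ) 1) {C D P : ℕ × ℕ} (hC : 0 < C.2) (hD : 0 < D.2) (hP : 0 < P.2)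
    (eC : (C.1 : ℚ) = c * C.2) (eD : (D.1 : ℚ) = d * D.2) (eP : (P.1 : ℚ) = x * P.2) :
    0 < (natStep C D P).2 ∧ ((natStep C D P).1 : ℚ) = bpamQ c d x * (natStep C D P).2 := by
  have qC : (0 : ℚ) < C.2 := by exact_mod_cast hC
  have qD : (0 : ℚ) < D.2 := by exact_mod_cast hD
  have qP : (0 : ℚ) < P.2 := by exact_mod_cast hP
  have hC1 : 0 < C.1 := by
    have : (0 : ℚ) < C.1 := by rw [eC]; positivity
    exact_mod_cast this
  have hC2 : C.1 < C.2 := by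
    have : (C.1 : ℚ) < C.2 := by rw [eC]; nlinarith
    exact_mod_cast this
  have hD2 : D.1 < D.2 := by
    have : (D.1 : ℚ) < D.2 := by rw [eD]; nlinarith
    exact_mod_cast this
  have hc' : 1 - c ≠ 0 := by linarith
  have hiff : P.1 * C.2 < C.1 * P.2 ↔ x < c := by
    have : (P.1 * C.2 < C.1 * P.2) ↔ ((P.1 : ℚ) * C.2 < C.1 * P.2) := by norm_cast
    rw [this, eP, eC]
    have e : c * (C.2 : ℚ) * P.2 = c * (P.2 * C.2) := by ring
    rw [e, mul_assoc]
    exact mul_lt_mul_iff_left₀ (by positivity)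
  unfold natStep
  by_cases h : x < c
  · rw [if_pos (hiff.2 h), bpamQ, if_pos ⟨hx.1, h⟩]
    refine ⟨by positivity, ?_⟩
    push_cast [Nat.cast_sub hD2.le]
    rw [eC, eD, eP]
    field_simp
  · have h' := mt hiff.1 h
    rw [if_neg h', bpamQ, if_neg (by tauto), if_pos ⟨not_lt.1 h, hx.2⟩]
    refine ⟨Nat.mul_pos (Nat.mul_pos hD (by omega)) hP, ?_⟩
    push_cast [Nat.cast_sub hC2.le, Nat.cast_sub (not_lt.1 h')]
    rw [eC, eD, eP]
    field_simp

theorem natIter_spec {c d x : ℚ} (hc : 0 < c) (hc1 : c < 1) (hd : 0 < d) (hd1 : d < 1)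
    (hx : x ∈ Set.Ico (0 : ℚ) 1) {C D P : ℕ × ℕ} (hC : 0 < C.2) (hD : 0 < D.2) (hP : 0 < P.2)
    (eC : (C.1 : ℚ) = c * C.2) (eD : (D.1 : ℚ) = d * D.2) (eP : (P.1 : ℚ) = x * P.2) (n : ℕ) :
    0 < ((natStep C D)^[n] P).2 ∧
      (((natStep C D)^[n] P).1 : ℚ) = (bpamQ c d)^[n] x * ((natStep C D)^[n] P).2 := by
  induction n with
  | zero => exact ⟨hP, eP⟩
  | succ n ih =>
    rw [Function.iterate_succ_apply', Function.iterate_succ_apply']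
    exact natStep_spec hc hc1 hd hd1 (iter_mem hc hc1 hd hd1 hx n) hC hD ih.1 eC eD ih.2

theorem ratPair_spec {q : ℚ} (h : 0 ≤ q) : 0 < (ratPair q).2 ∧ ((ratPair q).1 : ℚ) = q * (ratPair q).2 := by
  rw [ratPair_snd]
  refine ⟨q.pos, ?_⟩
  rw [Rat.mul_den_eq_num]
  exact_mod_cast ratPair_fst q h

/-- Reachability is decidable for bijective two-interval PAM. -/
theorem bpam_reachability_decidable :
    ∃ F : ℚ × ℚ × ℚ × ℚ → Bool, Computable F ∧
      ∀ c d x0 t : ℚ,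
        0 < c → c < 1 → 0 < d → d < 1 →
        x0 ∈ Set.Ico (0 : ℚ) 1 → t ∈ Set.Ico (0 : ℚ) 1 →
        (F (c, d, x0, t) = true ↔ ∃ n : ℕ, (bpamQ c d)^[n] x0 = t) := by
  classical
  refine ⟨fun v => decide (natReach (ratPair v.1, ratPair v.2.1, ratPair v.2.2.1, ratPair v.2.2.2)), ?_, ?_⟩
  · have hd : Computable (fun w => decide (natReach w)) := primrec_natReach.decide.to_comp
    refine hd.comp ?_
    have r := computable_ratPair
    exact (r.comp Computable.fst).pair ((r.comp (Computable.fst.comp Computable.snd)).pair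
      ((r.comp (Computable.fst.comp (Computable.snd.comp Computable.snd))).pair
        (r.comp (Computable.snd.comp (Computable.snd.comp Computable.snd)))))
  · intro c d x t hc hc1 hd hd1 hx ht
    obtain ⟨hC, eC⟩ := ratPair_spec hc.le
    obtain ⟨hD, eD⟩ := ratPair_spec hd.le
    obtain ⟨hX, eX⟩ := ratPair_spec hx.1
    obtain ⟨hT, eT⟩ := ratPair_spec ht.1
    have key : ∀ n, natTest (ratPair c) (ratPair d) (ratPair x) (ratPair t) n ↔ (bpamQ c d)^[n] x = t := by
      intro n
      obtain ⟨h1, h2⟩ := natIter_spec hc hc1 hd hd1 hx hC hD hX eC eD eX n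
      unfold natTest
      have q1 : ((((natStep (ratPair c) (ratPair d))^[n] (ratPair x)).2 : ℕ) : ℚ) ≠ 0 := by positivity
      have q2 : ((ratPair t).2 : ℚ) ≠ 0 := by positivity
      rw [← Nat.cast_inj (R := ℚ)]
      push_cast
      rw [h2, eT]
      constructor
      · intro h
        apply mul_right_cancel₀ (mul_ne_zero q1 q2)
        linarith
      · intro h
        rw [h]; ring
    have hB : natBound (ratPair c) (ratPair d) (ratPair x) (ratPair t) = c.den * d.den * x.den * t.den := by
      simp only [natBound, ratPair_snd]
    simp only [decide_eq_true_eq, natReach, List.mem_range, key]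
    constructor
    · rintro ⟨n, _, h⟩
      exact ⟨n, h⟩
    · rintro ⟨n, h⟩
      obtain ⟨n', h1, h2⟩ := reach_bound hc hc1 hd hd1 hx ht _ hB n h
      exact ⟨n', Nat.lt_succ_of_le h1, h2⟩
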